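/- Let ε ∈ {1, −1} and v = (e_1 + ε e_n)/√2 ∈ R^{p,q}. Let x ∈ R^n with ε·q(x) > 0 and ε·b(x,v) ≥ 0. For t ≥ 0 and u ∈ [0,1], set D(u,t) = 1 + tu⟨x,v⟩ + ε t² u² q(x)/4 (which is ≥ 1 under these hypotheses) and x(u,t) = D(u,t)^{−1}(ux + (t u² q(x)/2) v). Then sup_{u ∈ [0,1]} ‖x(u,t)‖ → 0 as t → +∞; that is, for every δ > 0 there exists T > 0 such that for all t ≥ T and all u ∈ [0,1], ‖x(u,t)‖ ≤ δ. -/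

import Mathlib

/-- The quadratic form `q` of signature `(p,q)` on `ℝ^n`, `n = p + q`. -/
noncomputable def qpq (p q : ℕ) (x : Fin (p + q) → ℝ) : ℝ :=
  2 * ∑ i : Fin p, x ⟨i, by omega⟩ * x ⟨p + q - 1 - i, by omega⟩
    + ∑ i : Fin (q - p), x ⟨p + i, by omega⟩ ^ 2

/-- The polarization `⟨·,·⟩` of `q`. -/
noncomputable def bpq (p q : ℕ) (x y : Fin (p + q) → ℝ) : ℝ :=
  ∑ i : Fin p,
      (x ⟨i, by omega⟩ * y ⟨p + q - 1 - i, by omega⟩ +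
        x ⟨p + q - 1 - i, by omega⟩ * y ⟨i, by omega⟩)
    + ∑ i : Fin (q - p), x ⟨p + i, by omega⟩ * y ⟨p + i, by omega⟩

/-- The Euclidean inner product `b(x,y) = x₁y₁ + ⋯ + x_ny_n` on `ℝ^n`. -/
noncomputable def bEucl (p q : ℕ) (x y : Fin (p + q) → ℝ) : ℝ :=
  ∑ i, x i * y i

/-- The Euclidean norm on `ℝ^n`. -/
noncomputable def eNorm (p q : ℕ) (x : Fin (p + q) → ℝ) : ℝ :=
  Real.sqrt (∑ i, x i ^ 2)

/-- The `k`-th standard basis vector of `ℝ^n` (0-indexed). -/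
noncomputable def stdb (p q : ℕ) (k : ℕ) : Fin (p + q) → ℝ :=
  fun j => if (j : ℕ) = k then 1 else 0

/-- The denominator `D(u,t) = 1 + tu⟨x,v⟩ + εt²u²q(x)/4`. -/
noncomputable def Dcoef (p q : ℕ) (ε : ℝ) (v x : Fin (p + q) → ℝ) (u t : ℝ) : ℝ :=
  1 + t * u * bpq p q x v + ε * t ^ 2 * u ^ 2 * qpq p q x / 4

/-- The orbit point `x(u,t) = D(u,t)⁻¹(ux + (tu²q(x)/2)v)`. -/
noncomputable def xut (p q : ℕ) (ε : ℝ) (v x : Fin (p + q) → ℝ) (u t : ℝ) :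
    Fin (p + q) → ℝ :=
  (Dcoef p q ε v x u t)⁻¹ • (u • x + (t * u ^ 2 * qpq p q x / 2) • v)

/-- For `v = (e₁ + ε e_n)/√2` with `ε = ±1`, one has `⟨x,v⟩ = ε b(x,v)`. -/
lemma bpq_eq_mul_bEucl (p q : ℕ) (hp : 1 ≤ p) (hpq : p ≤ q) (ε : ℝ) (hε : ε * ε = 1)
    (x : Fin (p + q) → ℝ) :
    bpq p q x ((Real.sqrt 2)⁻¹ • (stdb p q 0 + ε • stdb p q (p + q - 1))) =
      ε * bEucl p q x ((Real.sqrt 2)⁻¹ • (stdb p q 0 + ε • stdb p q (p + q - 1))) := by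
  have hfirst (k : ℕ) (hk : k < p + q) : ∑ i, x i * stdb p q k i = x ⟨k, hk⟩ := by
    rw [Finset.sum_eq_single ⟨k, hk⟩]
    · simp [stdb]
    · intro b _ hb
      have : (b : ℕ) ≠ k := fun h => hb (Fin.ext h)
      simp [stdb, this]
    · simp
  have hb : bEucl p q x ((Real.sqrt 2)⁻¹ • (stdb p q 0 + ε • stdb p q (p + q - 1))) =
      (Real.sqrt 2)⁻¹ * (x ⟨0, by omega⟩ + ε * x ⟨p + q - 1, by omega⟩) := by
    rw [← hfirst 0, ← hfirst (p + q - 1), Finset.mul_sum, ← Finset.sum_add_distrib,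
      Finset.mul_sum]
    refine Finset.sum_congr rfl fun i _ => ?_
    simp only [Pi.smul_apply, Pi.add_apply, smul_eq_mul]
    ring
  have hmid : ∑ i : Fin (q - p), x ⟨p + i, by omega⟩ *
      ((Real.sqrt 2)⁻¹ • (stdb p q 0 + ε • stdb p q (p + q - 1))) ⟨p + i, by omega⟩ = 0 := by
    refine Finset.sum_eq_zero fun i _ => ?_
    have h1 : p + (i : ℕ) ≠ 0 := by omega
    have h2 : p + (i : ℕ) ≠ p + q - 1 := by omega
    simp only [Pi.smul_apply, Pi.add_apply, smul_eq_mul, stdb, if_neg h1, if_neg h2]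
    ring
  rw [hb, bpq, hmid, Finset.sum_eq_single ⟨0, by omega⟩]
  · have h1 : p + q - 1 ≠ 0 := by omega
    have h2 : 0 ≠ p + q - 1 := by omega
    simp only [Pi.smul_apply, Pi.add_apply, smul_eq_mul, stdb, Nat.sub_zero, if_neg h1,
      if_neg h2, if_true]
    linear_combination (-(Real.sqrt 2)⁻¹ * x ⟨p + q - 1, by omega⟩) * hε
  · intro i _ hi
    have h0 : (i : ℕ) ≠ 0 := fun h => hi (Fin.ext h)
    have h1 : (i : ℕ) ≠ p + q - 1 := by omega
    have h2 : p + q - 1 - (i : ℕ) ≠ 0 := by omega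
    have h3 : p + q - 1 - (i : ℕ) ≠ p + q - 1 := by omega
    simp only [Pi.smul_apply, Pi.add_apply, smul_eq_mul, stdb, if_neg h0, if_neg h1,
      if_neg h2, if_neg h3]
    ring
  · simp

/-- A vector whose coordinates are bounded by `C i / t` has Euclidean norm at most `‖C‖ / t`. -/
lemma eNorm_le_div (p q : ℕ) (y C : Fin (p + q) → ℝ) {t : ℝ} (ht : 0 < t)
    (h : ∀ i, |y i| ≤ C i / t) : eNorm p q y ≤ eNorm p q C / t := by
  unfold eNorm
  rw [le_div_iff₀ ht, ← Real.sqrt_sq ht.le,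
    ← Real.sqrt_mul (Finset.sum_nonneg fun i _ => sq_nonneg _), Finset.sum_mul]
  refine Real.sqrt_le_sqrt (Finset.sum_le_sum fun i _ => ?_)
  have hi := (le_div_iff₀ ht).1 (h i)
  rw [← mul_pow, ← sq_abs, abs_mul, abs_of_pos ht]
  exact pow_le_pow_left₀ (by positivity) hi 2

/-- For `ε = ±1`, `v = (e₁ + ε e_n)/√2`, `ε q(x) > 0` and `ε b(x,v) ≥ 0`:
`sup_{u ∈ [0,1]} ‖x(u,t)‖ → 0` as `t → +∞`, i.e. for every `δ > 0` there is
`T > 0` with `‖x(u,t)‖ ≤ δ` for all `t ≥ T` and `u ∈ [0,1]`. -/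
theorem translation_flow_contraction (p q : ℕ) (hp : 1 ≤ p) (hpq : p ≤ q)
    (hn : 3 ≤ p + q) (ε : ℝ) (hε : ε = 1 ∨ ε = -1)
    (v : Fin (p + q) → ℝ)
    (hv : v = (Real.sqrt 2)⁻¹ • (stdb p q 0 + ε • stdb p q (p + q - 1)))
    (x : Fin (p + q) → ℝ) (hqx : ε * qpq p q x > 0)
    (hbx : ε * bEucl p q x v ≥ 0) :
    ∀ δ > (0 : ℝ), ∃ T > (0 : ℝ), ∀ t ≥ T, ∀ u ∈ Set.Icc (0 : ℝ) 1,
      eNorm p q (xut p q ε v x u t) ≤ δ := by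
  intro δ hδ
  have hεε : ε * ε = 1 := by rcases hε with rfl | rfl <;> norm_num
  have hεabs : |ε| = 1 := by rcases hε with rfl | rfl <;> norm_num
  have hb : 0 ≤ bpq p q x v := by
    rw [hv, bpq_eq_mul_bEucl p q hp hpq ε hεε x, ← hv]
    exact hbx
  set Q := ε * qpq p q x with hQ
  have hQabs : |qpq p q x| = Q := by
    rw [← abs_of_pos hqx, hQ, abs_mul, hεabs, one_mul]
  set r := Real.sqrt Q with hr
  have hr0 : 0 < r := Real.sqrt_pos.2 hqx
  have hrr : r ^ 2 = Q := Real.sq_sqrt hqx.le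
  let C : Fin (p + q) → ℝ := fun i => |x i| / r + 2 * |v i|
  have hC : 0 ≤ eNorm p q C := Real.sqrt_nonneg _
  refine ⟨eNorm p q C / δ + 1, by positivity, fun t ht u hu => ?_⟩
  have ht0 : 0 < t := lt_of_lt_of_le (by positivity) ht
  have hu0 : 0 ≤ u := hu.1
  have hD : 1 + (t * u) ^ 2 * r ^ 2 / 4 ≤ Dcoef p q ε v x u t := by
    have h1 : 0 ≤ t * u * bpq p q x v := by positivity
    have h2 : ε * t ^ 2 * u ^ 2 * qpq p q x / 4 = (t * u) ^ 2 * r ^ 2 / 4 := by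
      rw [hrr, hQ]
      ring
    rw [Dcoef, h2]
    linarith
  have hD0 : 0 < Dcoef p q ε v x u t := lt_of_lt_of_le (by positivity) hD
  have hfst : (Dcoef p q ε v x u t)⁻¹ * u ≤ 1 / r / t := by
    rw [inv_mul_eq_div, div_div, div_le_div_iff₀ hD0 (by positivity)]
    nlinarith [sq_nonneg (1 - t * u * r / 2)]
  have hsnd : (Dcoef p q ε v x u t)⁻¹ * (t * u ^ 2 * Q / 2) ≤ 2 / t := by
    rw [inv_mul_eq_div, div_le_div_iff₀ hD0 ht0, ← hrr]
    nlinarith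
  refine (eNorm_le_div p q _ C ht0 fun i => ?_).trans ?_
  · calc |xut p q ε v x u t i|
        = |(Dcoef p q ε v x u t)⁻¹ * u * x i +
            (Dcoef p q ε v x u t)⁻¹ * (t * u ^ 2 * qpq p q x / 2) * v i| := by
          simp only [xut, Pi.smul_apply, Pi.add_apply, smul_eq_mul]
          ring_nf
      _ ≤ (Dcoef p q ε v x u t)⁻¹ * u * |x i| +
            (Dcoef p q ε v x u t)⁻¹ * (t * u ^ 2 * Q / 2) * |v i| := by
          refine (abs_add_le _ _).trans_eq ?_
          simp only [abs_mul, abs_div, abs_inv, abs_pow, abs_of_pos hD0, abs_of_pos ht0,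
            abs_of_nonneg hu0, hQabs, abs_two]
      _ ≤ 1 / r / t * |x i| + 2 / t * |v i| := by gcongr
      _ = C i / t := by
          simp only [C]
          ring
  · rw [div_le_iff₀ ht0, ← div_le_iff₀' hδ]
    linarith
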